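/- Fix an integer n ≥ 3, a positive normalization constant τ̄, sign-preserving Lipschitz functions φ_1,…,φ_n, and real numbers u ≥ l > 0. Then the following are equivalent: (i) for every revision-rate vector λ with l ≤ λ_i ≤ u for all i, every x in the simplex X, and every p ∈ ℝ^n, one has Σ_{i=1}^n Σ_{j=1}^n x_j φ_i(p_i − p_j) λ_j (λ_i γ_i(p) − λ_j γ_j(p)) ≤ 0; (ii) for every k ∈ {1,…,n} and every p ∈ ℝ^n, Σ_{i=1}^n φ_i(p_i − p_k)((u/l) γ_i(p) − γ_k(p)) ≤ 0; (iii) u/l ≤ inf over k ∈ {1,…,n} and p ∈ ℝ^n with Σ_{i=1}^n φ_i(p_i − p_k) γ_i(p) ≠ 0 of γ_k(p) Σ_{i=1}^n φ_i(p_i − p_k) / Σ_{i=1}^n φ_i(p_i − p_k) γ_i(p). -/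

import Mathlib

open scoped BigOperators
open Finset

noncomputable section

namespace RMPC

/-- The probability simplex in `ℝ^n`. -/
def simplex (n : ℕ) : Set (Fin n → ℝ) :=
  {x | (∀ i, 0 ≤ x i) ∧ ∑ i, x i = 1}

/-- A function `φ : ℝ → ℝ` is sign-preserving if it is positive on positive
arguments and vanishes on nonpositive ones (hence takes values in `ℝ_{≥0}`). -/
def SignPreserving (φ : ℝ → ℝ) : Prop :=
  (∀ s : ℝ, 0 < s → 0 < φ s) ∧ (∀ s : ℝ, s ≤ 0 → φ s = 0)

/-- The RM-PC mean dynamics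
`V_i(x,p) = Σ_{j≠i} λ_j (1/τ̄) φ_i(p_i − p_j) x_j − Σ_{j≠i} λ_i (1/τ̄) φ_j(p_j − p_i) x_i`. -/
def Vdyn (n : ℕ) (lam : Fin n → ℝ) (τ : ℝ) (φ : Fin n → ℝ → ℝ)
    (x p : Fin n → ℝ) (i : Fin n) : ℝ :=
  (∑ j ∈ Finset.univ.erase i, lam j * (1 / τ) * φ i (p i - p j) * x j)
    - ∑ j ∈ Finset.univ.erase i, lam i * (1 / τ) * φ j (p j - p i) * x i

/-- `ψ(s) = ∫_0^s φ(r) dr`. -/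
def psiF (φ : ℝ → ℝ) (s : ℝ) : ℝ := ∫ r in (0:ℝ)..s, φ r

/-- `γ_i(p) = Σ_k ψ_k(p_k − p_i)`. -/
def gammaF (n : ℕ) (φ : Fin n → ℝ → ℝ) (i : Fin n) (p : Fin n → ℝ) : ℝ :=
  ∑ k, psiF (φ k) (p k - p i)

/-- Worst-case revision rate ratio `λ_R = max { λ_i / λ_j }`. -/
def lamR (n : ℕ) (lam : Fin n → ℝ) : ℝ :=
  ⨆ ij : Fin n × Fin n, lam ij.1 / lam ij.2

/-- The set of values `γ_k(p) Σ_i φ_i(p_i − p_k) / Σ_i φ_i(p_i − p_k) γ_i(p)`,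
over `p` with nonvanishing denominator. -/
def thresholdSet (n : ℕ) (φ : Fin n → ℝ → ℝ) (k : Fin n) : Set ℝ :=
  {c | ∃ p : Fin n → ℝ,
    (∑ i, φ i (p i - p k) * gammaF n φ i p) ≠ 0 ∧
    c = (gammaF n φ k p * ∑ i, φ i (p i - p k)) /
        (∑ i, φ i (p i - p k) * gammaF n φ i p)}

/-- The threshold `λ̄_φ(n)`. -/
def lamBar (n : ℕ) (φ : Fin n → ℝ → ℝ) : ℝ :=
  ⨅ k : Fin n, sInf (thresholdSet n φ k)

/-- The δ-storage function `S(x,p) = (1/τ̄) Σ_i λ_i x_i γ_i(p)`. -/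
def Sfun (n : ℕ) (lam : Fin n → ℝ) (τ : ℝ) (φ : Fin n → ℝ → ℝ)
    (x p : Fin n → ℝ) : ℝ :=
  (1 / τ) * ∑ i, lam i * x i * gammaF n φ i p

/-- The dissipation rate `𝔖(x,p) = −(1/τ̄) Σ_i λ_i V_i(x,p) γ_i(p)`. -/
def SigFun (n : ℕ) (lam : Fin n → ℝ) (τ : ℝ) (φ : Fin n → ℝ → ℝ)
    (x p : Fin n → ℝ) : ℝ :=
  -((1 / τ) * ∑ i, lam i * Vdyn n lam τ φ x p i * gammaF n φ i p)

theorem phi_nonneg {f : ℝ → ℝ} (h : SignPreserving f) (s : ℝ) : 0 ≤ f s := by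
  rcases le_or_gt s 0 with hs | hs
  · exact (h.2 s hs).ge
  · exact (h.1 s hs).le

theorem psi_nonneg {f : ℝ → ℝ} (h : SignPreserving f) (s : ℝ) : 0 ≤ psiF f s := by
  unfold psiF
  rcases le_total s 0 with hs | hs
  · have : ∫ r in (0:ℝ)..s, f r = ∫ r in (0:ℝ)..s, (0:ℝ) := by
      apply intervalIntegral.integral_congr
      intro r hr
      rw [Set.uIcc_of_ge hs] at hr
      exact h.2 r hr.2
    rw [this]; simp
  · exact intervalIntegral.integral_nonneg hs (fun r _ => phi_nonneg h r)

theorem psi_pos {f : ℝ → ℝ} (h : SignPreserving f) (hc : Continuous f) (s : ℝ) (hs : 0 < s) :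
    0 < psiF f s := by
  unfold psiF
  exact intervalIntegral.intervalIntegral_pos_of_pos_on (hc.intervalIntegrable _ _)
    (fun x hx => h.1 x hx.1) hs

theorem gamma_nonneg (n : ℕ) (φ : Fin n → ℝ → ℝ) (hφ : ∀ j, SignPreserving (φ j)) (i : Fin n)
    (p : Fin n → ℝ) : 0 ≤ gammaF n φ i p :=
  Finset.sum_nonneg (fun k _ => psi_nonneg (hφ k) _)

theorem exists_den (n : ℕ) (hn : 3 ≤ n) (φ : Fin n → ℝ → ℝ) (hφ : ∀ j, SignPreserving (φ j))
    (hc : ∀ j, Continuous (φ j)) : ∃ (k : Fin n) (p : Fin n → ℝ),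
      (∑ i, φ i (p i - p k) * gammaF n φ i p) ≠ 0 := by
  refine ⟨⟨0, by omega⟩, fun i => (i.val : ℝ), ne_of_gt ?_⟩
  apply Finset.sum_pos'
  · intro i _
    exact mul_nonneg (phi_nonneg (hφ i) _) (gamma_nonneg n φ hφ i _)
  · refine ⟨⟨1, by omega⟩, Finset.mem_univ _, mul_pos ((hφ _).1 _ (by norm_num)) ?_⟩
    apply Finset.sum_pos' (fun k _ => psi_nonneg (hφ k) _)
    exact ⟨⟨2, by omega⟩, Finset.mem_univ _, psi_pos (hφ _) (hc _) _ (by norm_num)⟩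

/-- Equivalence of the three conditions used in the proof of Theorem 1 (case `n ≥ 3`):
the box condition over revision rates, the extremal-ratio inequality, and the
infimum characterization. -/
theorem box_condition_equivalences (n : ℕ) (hn : 3 ≤ n)
    (τ : ℝ) (hτ : 0 < τ)
    (φ : Fin n → ℝ → ℝ)
    (hφ : ∀ j, SignPreserving (φ j))
    (hLip : ∀ j, ∃ K, LipschitzWith K (φ j))
    (u l : ℝ) (hl : 0 < l) (hul : l ≤ u) :
    ((∀ lam : Fin n → ℝ, (∀ i, l ≤ lam i ∧ lam i ≤ u) →
        ∀ x ∈ simplex n, ∀ p : Fin n → ℝ,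
          (∑ i, ∑ j, x j * φ i (p i - p j) * lam j *
            (lam i * gammaF n φ i p - lam j * gammaF n φ j p)) ≤ 0) ↔
      (∀ k : Fin n, ∀ p : Fin n → ℝ,
        (∑ i, φ i (p i - p k) * ((u / l) * gammaF n φ i p - gammaF n φ k p)) ≤ 0)) ∧
    ((∀ k : Fin n, ∀ p : Fin n → ℝ,
        (∑ i, φ i (p i - p k) * ((u / l) * gammaF n φ i p - gammaF n φ k p)) ≤ 0) ↔
      u / l ≤ sInf {c | ∃ (k : Fin n) (p : Fin n → ℝ),
        (∑ i, φ i (p i - p k) * gammaF n φ i p) ≠ 0 ∧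
        c = (gammaF n φ k p * ∑ i, φ i (p i - p k)) /
            (∑ i, φ i (p i - p k) * gammaF n φ i p)}) := by
  have hc : ∀ j, Continuous (φ j) := fun j => (hLip j).choose_spec.continuous
  have hf := fun (i : Fin n) (s : ℝ) => phi_nonneg (hφ i) s
  have hg := fun (i : Fin n) (p : Fin n → ℝ) => gamma_nonneg n φ hφ i p
  have hu : 0 < u := hl.trans_le hul
  have hD : ∀ (k : Fin n) (p : Fin n → ℝ), 0 ≤ ∑ i, φ i (p i - p k) * gammaF n φ i p :=
    fun k p => Finset.sum_nonneg (fun i _ => mul_nonneg (hf i _) (hg i p))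
  have hN : ∀ (k : Fin n) (p : Fin n → ℝ), 0 ≤ gammaF n φ k p * ∑ i, φ i (p i - p k) :=
    fun k p => mul_nonneg (hg k p) (Finset.sum_nonneg (fun i _ => hf i _))
  have hE : ∀ (k : Fin n) (p : Fin n → ℝ),
      (∑ i, φ i (p i - p k) * ((u / l) * gammaF n φ i p - gammaF n φ k p)) =
      (u / l) * (∑ i, φ i (p i - p k) * gammaF n φ i p)
        - gammaF n φ k p * ∑ i, φ i (p i - p k) := by
    intro k p
    rw [Finset.mul_sum, Finset.mul_sum, ← Finset.sum_sub_distrib]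
    exact Finset.sum_congr rfl (fun i _ => by ring)
  refine ⟨⟨?_, ?_⟩, ⟨?_, ?_⟩⟩
  · intro h k p
    have h1 := h (fun i => if i = k then l else u)
      (fun i => by split_ifs <;> constructor <;> linarith)
      (fun i => if i = k then 1 else 0)
      ⟨fun i => by dsimp only; split_ifs <;> norm_num, by simp⟩ p
    have h2 : ∀ i, (∑ j, (if j = k then (1:ℝ) else 0) * φ i (p i - p j) *
        (if j = k then l else u) * ((if i = k then l else u) * gammaF n φ i p -
          (if j = k then l else u) * gammaF n φ j p)) =
        l ^ 2 * (φ i (p i - p k) * ((u / l) * gammaF n φ i p - gammaF n φ k p)) := by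
      intro i
      rw [Finset.sum_eq_single k]
      · by_cases hik : i = k
        · subst hik
          simp [(hφ i).2 0 le_rfl]
        · simp only [if_true, if_neg hik]
          field_simp
      · intro j _ hj
        simp [hj]
      · simp
    simp only [h2] at h1
    rw [← Finset.mul_sum] at h1
    by_contra hcon
    push Not at hcon
    have := mul_pos (pow_pos hl 2) hcon
    linarith
  · intro h lam hlam x hx p
    rw [Finset.sum_comm]
    apply Finset.sum_nonpos
    intro j _
    have hj : 0 < lam j := hl.trans_le (hlam j).1
    have h1 : (∑ i, x j * φ i (p i - p j) * lam j *
        (lam i * gammaF n φ i p - lam j * gammaF n φ j p)) ≤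
        ∑ i, (x j * lam j * lam j) *
          (φ i (p i - p j) * ((u / l) * gammaF n φ i p - gammaF n φ j p)) := by
      apply Finset.sum_le_sum
      intro i _
      have h3 : lam i ≤ lam j * (u / l) := by
        rw [← mul_div_assoc, le_div_iff₀ hl]
        have h4 := (hlam j).1
        have h5 := (hlam i).2
        nlinarith
      have h4 : lam i * gammaF n φ i p - lam j * gammaF n φ j p ≤
          lam j * ((u / l) * gammaF n φ i p - gammaF n φ j p) := by
        have := mul_le_mul_of_nonneg_right h3 (hg i p)
        linarith
      have h5 : 0 ≤ x j * φ i (p i - p j) * lam j :=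
        mul_nonneg (mul_nonneg (hx.1 j) (hf i _)) hj.le
      refine (mul_le_mul_of_nonneg_left h4 h5).trans (le_of_eq (by ring))
    rw [← Finset.mul_sum] at h1
    exact h1.trans (mul_nonpos_of_nonneg_of_nonpos
      (mul_nonneg (mul_nonneg (hx.1 j) hj.le) hj.le) (h j p))
  · intro h
    obtain ⟨k, p, hkp⟩ := exists_den n hn φ hφ hc
    refine le_csInf ⟨_, k, p, hkp, rfl⟩ ?_
    rintro c ⟨k, p, hne, rfl⟩
    rw [le_div_iff₀ (lt_of_le_of_ne (hD k p) hne.symm)]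
    have := h k p
    rw [hE] at this
    linarith
  · intro h k p
    rw [hE]
    by_cases hne : (∑ i, φ i (p i - p k) * gammaF n φ i p) = 0
    · rw [hne]
      have := hN k p
      linarith
    · have h1 := h.trans (csInf_le ⟨0, by
        rintro c ⟨k, p, _, rfl⟩
        exact div_nonneg (hN k p) (hD k p)⟩ ⟨k, p, hne, rfl⟩)
      rw [le_div_iff₀ (lt_of_le_of_ne (hD k p) (Ne.symm hne))] at h1
      linarith

end RMPC
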